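/- Let 𝒯=(V,ℰ) be a leafless, locally finite rooted directed tree, q ≥ 1 a real number, S_{λ,q} the Dirichlet shift on ℓ²(V), and S'_{λ,q} = S_{λ,q}(S_{λ,q}*S_{λ,q})^{-1} its Cauchy dual. Then for all f, g ∈ ker S_{λ,q}* and all m, n ∈ ℕ with m ≠ n, one has ⟨S_{λ,q}^m f, S_{λ,q}^n g⟩ = 0 and ⟨(S'_{λ,q})^m f, (S'_{λ,q})^n g⟩ = 0 (note that ker S'_{λ,q}* = ker S_{λ,q}*). -/

import Mathlib

open scoped ENNReal InnerProductSpace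
open ContinuousLinearMap

noncomputable section

/-- A (countably infinite) rooted directed tree. -/
structure DirTree (V : Type) where
  edge : V → V → Prop
  not_self : ∀ v, ¬ edge v v
  no_circuit : ∀ v, ¬ Relation.TransGen edge v v
  connected : ∀ u v : V, Relation.ReflTransGen (fun a b => edge a b ∨ edge b a) u v
  uniq_parent : ∀ {u w v : V}, edge u v → edge w v → u = w
  root : V
  root_no_parent : ∀ u, ¬ edge u root
  root_uniq : ∀ v, (∀ u, ¬ edge u v) → v = root

namespace DirTree

variable {V : Type} (T : DirTree V)

/-- The set of children of a vertex. -/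
def chi (v : V) : Set V := {u | T.edge v u}

/-- Leafless: every vertex has a child. -/
def Leafless : Prop := ∀ v : V, ∃ u, T.edge v u

/-- Locally finite: every vertex has finitely many children. -/
def LocFin : Prop := ∀ v : V, (T.chi v).Finite

/-- The finset of children of a vertex (locally finite case). -/
def chiFin (hT : T.LocFin) (v : V) : Finset V := (hT v).toFinset

/-- Iterated child sets `Chi^⟨n⟩(W)`. -/
def chiIter (T : DirTree V) : ℕ → Set V → Set V
  | 0, W => W
  | n + 1, W => {u | ∃ v ∈ chiIter T n W, T.edge v u}

/-- The depth of a vertex: the unique `n` with `v ∈ Chi^⟨n⟩(root)`. -/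
def depth (v : V) : ℕ := sInf {n | v ∈ T.chiIter n {T.root}}

/-- The parent map (junk value at the root). -/
def par (v : V) : V :=
  letI := Classical.propDecidable (∃ u, T.edge u v)
  if h : ∃ u, T.edge u v then h.choose else v

end DirTree

/-- `ℓ²(V)`. -/
abbrev l2 (V : Type) := lp (fun _ : V => ℂ) 2

/-- The standard orthonormal basis vector `e_v` of `ℓ²(V)`. -/
def evec {V : Type} (v : V) : l2 V :=
  letI := Classical.decEq V
  lp.single 2 v 1

/-- The Pochhammer symbol `(x)_k = x (x+1) ⋯ (x+k-1)`. -/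
def poch (x : ℝ) (k : ℕ) : ℝ := ∏ i ∈ Finset.range k, (x + i)

namespace DirTree

variable {V : Type} (T : DirTree V)

/-- The weight `λ_{u,q}` (for any child `u` of `v`). -/
def wt (hT : T.LocFin) (q : ℝ) (v : V) : ℝ :=
  Real.sqrt (((T.depth v : ℝ) + q) / ((T.depth v : ℝ) + 1)) /
    Real.sqrt ((T.chiFin hT v).card)

/-- `S` is the Dirichlet shift with parameter `q` on `ℓ²(V)`:
`S e_v = ∑_{u ∈ Chi(v)} λ_{u,q} e_u`. -/
def IsDirichletShift (hT : T.LocFin) (q : ℝ) (S : l2 V →L[ℂ] l2 V) : Prop :=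
  ∀ v : V, S (evec v) = ∑ u ∈ T.chiFin hT v, ((T.wt hT q v : ℝ) : ℂ) • evec u

end DirTree

/-- The Cauchy dual `S (S*S)⁻¹` of a left-invertible operator. -/
def cauchyDual {V : Type} (S : l2 V →L[ℂ] l2 V) : l2 V →L[ℂ] l2 V :=
  S * Ring.inverse (ContinuousLinearMap.adjoint S * S)

namespace DirTree

variable {V : Type} (T : DirTree V)

lemma mem_chiIter_of_edge {v u : V} (h : T.edge v u) (n : ℕ) :
    u ∈ T.chiIter n {T.root} ↔ ∃ k, n = k + 1 ∧ v ∈ T.chiIter k {T.root} := by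
  cases n with
  | zero =>
    simp only [chiIter, Set.mem_singleton_iff]
    constructor
    · rintro rfl
      exact absurd h (T.root_no_parent v)
    · rintro ⟨k, hk, -⟩
      omega
  | succ n =>
    constructor
    · rintro ⟨w, hw, hwu⟩
      obtain rfl := T.uniq_parent h hwu
      exact ⟨n, rfl, hw⟩
    · rintro ⟨k, hk, hv⟩
      obtain rfl : n = k := by omega
      exact ⟨v, hv, h⟩

lemma exists_mem_chiIter (v : V) : ∃ n, v ∈ T.chiIter n {T.root} := by
  induction T.connected T.root v with
  | refl => exact ⟨0, rfl⟩
  | tail _ hbc ih =>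
    obtain ⟨n, hn⟩ := ih
    rcases hbc with hbc | hcb
    · exact ⟨n + 1, _, hn, hbc⟩
    · obtain ⟨k, -, hk⟩ := (T.mem_chiIter_of_edge hcb n).1 hn
      exact ⟨k, hk⟩

lemma depth_of_edge {v u : V} (h : T.edge v u) : T.depth u = T.depth v + 1 := by
  have hv : v ∈ T.chiIter (T.depth v) {T.root} := Nat.sInf_mem (T.exists_mem_chiIter v)
  have hu : u ∈ T.chiIter (T.depth u) {T.root} := Nat.sInf_mem (T.exists_mem_chiIter u)
  obtain ⟨k, hk, hvk⟩ := (T.mem_chiIter_of_edge h _).1 hu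
  have hle : T.depth u ≤ T.depth v + 1 :=
    Nat.sInf_le ((T.mem_chiIter_of_edge h _).2 ⟨_, rfl, hv⟩)
  have hge : T.depth v ≤ k := Nat.sInf_le hvk
  omega

lemma mem_chiFin (hT : T.LocFin) {v u : V} : u ∈ T.chiFin hT v ↔ T.edge v u := by
  simp [chiFin, chi]

/-- `h'` is the product of `h` with the function `φ` of the depth. -/
def IsRadialMul (φ : ℕ → ℂ) (h h' : l2 V) : Prop :=
  ∀ v, h' v = φ (T.depth v) * h v

lemma exists_isRadialMul {φ : ℕ → ℂ} {C : ℝ} (hφ : ∀ k, ‖φ k‖ ≤ C) (h : l2 V) :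
    ∃ h', T.IsRadialMul φ h h' := by
  have hmem : Memℓp (fun v => φ (T.depth v) * h v) 2 := by
    refine ((lp.memℓp h).const_smul (C : ℂ)).mono' ?_
    intro v
    have hC : 0 ≤ C := (norm_nonneg _).trans (hφ 0)
    rw [Pi.smul_apply, smul_eq_mul, norm_mul, norm_mul, Complex.norm_real,
      Real.norm_of_nonneg hC]
    gcongr
    exact hφ _
  exact ⟨⟨_, hmem⟩, fun v => rfl⟩

end DirTree

lemma inner_evec {V : Type} (v : V) (x : l2 V) : ⟪evec v, x⟫_ℂ = x v := by
  classical
  unfold evec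
  rw [lp.inner_single_left]
  simp

lemma evec_apply_self {V : Type} (v : V) : (evec v : l2 V) v = 1 := by
  unfold evec
  simp

lemma evec_apply_of_ne {V : Type} {v u : V} (h : u ≠ v) : (evec v : l2 V) u = 0 := by
  unfold evec
  simp [h]

namespace DirTree.IsDirichletShift

variable {V : Type} {T : DirTree V} {hT : T.LocFin} {q : ℝ} {S : l2 V →L[ℂ] l2 V}

lemma adjoint_apply (hS : T.IsDirichletShift hT q S) (x : l2 V) (v : V) :
    (adjoint S x) v = (T.wt hT q v : ℂ) * ∑ u ∈ T.chiFin hT v, x u := by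
  rw [← inner_evec, adjoint_inner_right, hS v, sum_inner, Finset.mul_sum]
  refine Finset.sum_congr rfl fun u _ => ?_
  rw [inner_smul_left, inner_evec, Complex.conj_ofReal]

lemma apply_root (hS : T.IsDirichletShift hT q S) (x : l2 V) : (S x) T.root = 0 := by
  have h : adjoint S (evec T.root) = 0 := by
    ext v
    rw [hS.adjoint_apply, Finset.sum_eq_zero]
    · simp
    · intro u hu
      refine evec_apply_of_ne ?_
      rintro rfl
      exact T.root_no_parent v ((T.mem_chiFin hT).1 hu)
  rw [← inner_evec, ← adjoint_inner_left, h, inner_zero_left]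

lemma apply_of_edge (hS : T.IsDirichletShift hT q S) (x : l2 V) {v u : V} (hvu : T.edge v u) :
    (S x) u = (T.wt hT q v : ℂ) * x v := by
  have h : adjoint S (evec u) = (T.wt hT q v : ℂ) • evec v := by
    ext w
    rw [hS.adjoint_apply, lp.coeFn_smul, Pi.smul_apply, smul_eq_mul]
    by_cases hw : w = v
    · subst hw
      rw [evec_apply_self, Finset.sum_eq_single u, evec_apply_self]
      · exact fun b _ hb => evec_apply_of_ne hb
      · exact fun hu => absurd ((T.mem_chiFin hT).2 hvu) hu
    · rw [evec_apply_of_ne hw, Finset.sum_eq_zero]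
      · simp
      · intro b hb
        refine evec_apply_of_ne ?_
        rintro rfl
        exact hw (T.uniq_parent ((T.mem_chiFin hT).1 hb) hvu)
  rw [← inner_evec, ← adjoint_inner_left, h, inner_smul_left, inner_evec, Complex.conj_ofReal]

lemma adjoint_mul_self_apply (hS : T.IsDirichletShift hT q S) (hL : T.Leafless) (hq : 1 ≤ q)
    (x : l2 V) :
    T.IsRadialMul (fun k => (((k + q) / (k + 1) : ℝ) : ℂ)) x (adjoint S (S x)) := by
  intro v
  have hcard : (0 : ℝ) < (T.chiFin hT v).card := by
    obtain ⟨u, hu⟩ := hL v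
    exact_mod_cast Finset.card_pos.2 ⟨u, (T.mem_chiFin hT).2 hu⟩
  have hwt : T.wt hT q v * ((T.chiFin hT v).card * T.wt hT q v) =
      ((T.depth v : ℝ) + q) / ((T.depth v : ℝ) + 1) := by
    have h0 : (0 : ℝ) ≤ ((T.depth v : ℝ) + q) / ((T.depth v : ℝ) + 1) := by positivity
    have h3 := Real.sqrt_pos.2 hcard
    unfold wt
    generalize ((T.depth v : ℝ) + q) / ((T.depth v : ℝ) + 1) = c at h0 ⊢
    field_simp
    rw [Real.sq_sqrt h0, Real.sq_sqrt hcard.le]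
    ring
  have hsum : ∑ u ∈ T.chiFin hT v, (S x) u =
      ∑ _u ∈ T.chiFin hT v, (T.wt hT q v : ℂ) * x v :=
    Finset.sum_congr rfl fun u hu => hS.apply_of_edge x ((T.mem_chiFin hT).1 hu)
  rw [hS.adjoint_apply, hsum, Finset.sum_const, nsmul_eq_mul]
  beta_reduce
  rw [← hwt]
  push_cast
  ring

lemma isRadialMul_apply (hS : T.IsDirichletShift hT q S) {φ : ℕ → ℂ} {h h' : l2 V}
    (H : T.IsRadialMul (fun k => φ (k + 1)) h h') : T.IsRadialMul φ (S h) (S h') := by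
  intro u
  by_cases hu : ∃ v, T.edge v u
  · obtain ⟨v, hv⟩ := hu
    rw [hS.apply_of_edge _ hv, hS.apply_of_edge _ hv, H v, T.depth_of_edge hv]
    ring
  · obtain rfl := T.root_uniq u (not_exists.1 hu)
    rw [hS.apply_root, hS.apply_root, mul_zero]

lemma adjoint_eq_zero_of_isRadialMul (hS : T.IsDirichletShift hT q S) {φ : ℕ → ℂ}
    {h h' : l2 V} (H : T.IsRadialMul φ h h') (h0 : adjoint S h = 0) : adjoint S h' = 0 := by
  ext v
  have hv : (adjoint S h) v = 0 := by rw [h0]; rfl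
  rw [hS.adjoint_apply] at hv
  rw [hS.adjoint_apply, Finset.sum_congr rfl fun u hu => by
    rw [H u, T.depth_of_edge ((T.mem_chiFin hT).1 hu)], ← Finset.mul_sum, mul_left_comm, hv,
    mul_zero]
  rfl

/-- Multiplication by a bounded function of the depth preserves `S ^ n (ker S*)`. -/
lemma exists_pow_of_isRadialMul (hS : T.IsDirichletShift hT q S) (n : ℕ) {φ : ℕ → ℂ} {C : ℝ}
    (hφ : ∀ k, ‖φ k‖ ≤ C) {f h' : l2 V} (hf : adjoint S f = 0)
    (H : T.IsRadialMul φ ((S ^ n) f) h') : ∃ f', adjoint S f' = 0 ∧ h' = (S ^ n) f' := by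
  obtain ⟨f', hf'⟩ := T.exists_isRadialMul (φ := fun k => φ (k + n)) (fun k => hφ _) f
  refine ⟨f', hS.adjoint_eq_zero_of_isRadialMul hf' hf, ?_⟩
  have key : ∀ (n : ℕ) (ψ : ℕ → ℂ), T.IsRadialMul (fun k => ψ (k + n)) f f' →
      T.IsRadialMul ψ ((S ^ n) f) ((S ^ n) f') := by
    intro n
    induction n with
    | zero => exact fun ψ hψ => hψ
    | succ n ih =>
      intro ψ hψ
      rw [pow_succ']
      refine hS.isRadialMul_apply (ih (fun k => ψ (k + 1)) ?_)
      simpa only [add_assoc, add_comm 1] using hψ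
  ext v
  rw [H v, key n φ hf' v]

lemma inner_pow_eq_zero_of_lt (hS : T.IsDirichletShift hT q S) (hL : T.Leafless) (hq : 1 ≤ q)
    {m n : ℕ} (hmn : m < n) {f g : l2 V} (hf : adjoint S f = 0) (hg : adjoint S g = 0) :
    ⟪(S ^ m) f, (S ^ n) g⟫_ℂ = 0 := by
  induction m generalizing n g with
  | zero =>
    obtain ⟨n, rfl⟩ := Nat.exists_eq_add_of_lt hmn
    rw [pow_succ', mul_apply_eq_comp, ← adjoint_inner_left, pow_zero,
      one_apply_eq_self, hf, inner_zero_left]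
  | succ m ih =>
    obtain ⟨n, rfl⟩ : ∃ k, n = k + 1 := ⟨n - 1, by omega⟩
    have hφ : ∀ k : ℕ, ‖(((k + q) / (k + 1) : ℝ) : ℂ)‖ ≤ q := by
      intro k
      rw [Complex.norm_real, Real.norm_of_nonneg (by positivity), div_le_iff₀ (by positivity)]
      nlinarith [(Nat.cast_nonneg k : (0 : ℝ) ≤ k)]
    obtain ⟨g', hg', h⟩ := hS.exists_pow_of_isRadialMul n hφ hg
      (hS.adjoint_mul_self_apply hL hq ((S ^ n) g))
    rw [pow_succ', pow_succ', mul_apply_eq_comp, mul_apply_eq_comp,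
      ← adjoint_inner_right, h]
    exact ih (by omega) hg'

lemma inner_pow_eq_zero (hS : T.IsDirichletShift hT q S) (hL : T.Leafless) (hq : 1 ≤ q)
    {m n : ℕ} (hmn : m ≠ n) {f g : l2 V} (hf : adjoint S f = 0) (hg : adjoint S g = 0) :
    ⟪(S ^ m) f, (S ^ n) g⟫_ℂ = 0 := by
  rcases hmn.lt_or_gt with h | h
  · exact hS.inner_pow_eq_zero_of_lt hL hq h hf hg
  · rw [inner_eq_zero_symm]
    exact hS.inner_pow_eq_zero_of_lt hL hq h hg hf

/-- Powers of the Cauchy dual map `ker S*` into `S ^ n (ker S*)`. -/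
lemma exists_cauchyDual_pow_eq (hS : T.IsDirichletShift hT q S) (hL : T.Leafless) (hq : 1 ≤ q)
    (hU : IsUnit (adjoint S * S)) (n : ℕ) {f : l2 V} (hf : adjoint S f = 0) :
    ∃ f', adjoint S f' = 0 ∧ (cauchyDual S ^ n) f = (S ^ n) f' := by
  induction n with
  | zero => exact ⟨f, hf, rfl⟩
  | succ n ih =>
    obtain ⟨g, hg, h⟩ := ih
    set x := Ring.inverse (adjoint S * S) ((S ^ n) g) with hx
    have hSx : adjoint S (S x) = (S ^ n) g :=
      congrArg (fun A : l2 V →L[ℂ] l2 V => A ((S ^ n) g)) (Ring.mul_inverse_cancel _ hU)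
    have hφ : ∀ k : ℕ, ‖((((k + q) / (k + 1) : ℝ) : ℂ))⁻¹‖ ≤ 1 := by
      intro k
      rw [norm_inv, Complex.norm_real, Real.norm_of_nonneg (by positivity)]
      refine inv_le_one_of_one_le₀ ?_
      rw [one_le_div (by positivity)]
      linarith
    have hrad : T.IsRadialMul (fun k => (((k + q) / (k + 1) : ℝ) : ℂ)⁻¹) ((S ^ n) g) x := by
      intro v
      rw [← hSx, hS.adjoint_mul_self_apply hL hq x v, inv_mul_cancel_left₀]
      exact Complex.ofReal_ne_zero.2 (by positivity)
    obtain ⟨f', hf', hxf⟩ := hS.exists_pow_of_isRadialMul n hφ hg hrad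
    refine ⟨f', hf', ?_⟩
    rw [pow_succ', pow_succ', mul_apply_eq_comp, mul_apply_eq_comp, h,
      ← hxf, hx]
    rfl

end DirTree.IsDirichletShift

theorem stmt_6 {V : Type} [Countable V] [Infinite V] (T : DirTree V)
    (hL : T.Leafless) (hT : T.LocFin) (q : ℝ) (hq : 1 ≤ q)
    (S : l2 V →L[ℂ] l2 V) (hS : T.IsDirichletShift hT q S) :
    ∀ f g : l2 V, ContinuousLinearMap.adjoint S f = 0 →
      ContinuousLinearMap.adjoint S g = 0 →
      ∀ m n : ℕ, m ≠ n →
        ⟪(S ^ m) f, (S ^ n) g⟫_ℂ = 0 ∧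
        ⟪(cauchyDual S ^ m) f, (cauchyDual S ^ n) g⟫_ℂ = 0 := by
  intro f g hf hg m n hmn
  refine ⟨hS.inner_pow_eq_zero hL hq hmn hf hg, ?_⟩
  by_cases hU : IsUnit (adjoint S * S)
  · obtain ⟨f', hf', h₁⟩ := hS.exists_cauchyDual_pow_eq hL hq hU m hf
    obtain ⟨g', hg', h₂⟩ := hS.exists_cauchyDual_pow_eq hL hq hU n hg
    rw [h₁, h₂]
    exact hS.inner_pow_eq_zero hL hq hmn hf' hg'
  · have h0 : cauchyDual S = 0 := by
      rw [cauchyDual, Ring.inverse_non_unit _ hU, mul_zero]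
    rcases Nat.eq_zero_or_pos m with rfl | hm
    · rw [h0, zero_pow hmn.symm, _root_.zero_apply, inner_zero_right]
    · rw [h0, zero_pow hm.ne', _root_.zero_apply, inner_zero_left]

end
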